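/- arXiv:2502.14105 — 5 statements merged into one kernel-verified Lean document; each statement's English description precedes it below -/
import Mathlib

section
/- Let P, Q be Borel probability measures on Z, let ε ≥ 0 and ρ ∈ [0,1]. Then LP_ε(P,Q) ≤ ρ if and only if there exists a Borel probability measure P̃ on Z such that LP_ε(P, P̃) = 0 and TV(P̃, Q) ≤ ρ. (Decomposition of the LP ambiguity set: Q ∈ B_{ε,ρ}(P) iff Q can be obtained from P by a local ∞-Wasserstein perturbation of size ε followed by a global total-variation perturbation of size ρ.) -/
open MeasureTheory

/-- The Lévy–Prokhorov discrepancy `LP_ε(P,Q)`: infimum over all couplings `γ` of `P` and `Q`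
of the `γ`-mass of the set where `‖z₁ - z₂‖ > ε`. -/
noncomputable def LPdist {E : Type*} [NormedAddCommGroup E] [MeasurableSpace E]
    (ε : ℝ) (P Q : Measure E) : ENNReal :=
  ⨅ (γ : Measure (E × E)) (_ : γ.map Prod.fst = P ∧ γ.map Prod.snd = Q),
    γ {p : E × E | ε < ‖p.1 - p.2‖}

/-- The total variation discrepancy: infimum over all couplings `γ` of `P` and `Q`
of the `γ`-mass of the off-diagonal set. -/
noncomputable def TVdist {E : Type*} [MeasurableSpace E] (P Q : Measure E) : ENNReal :=
  ⨅ (γ : Measure (E × E)) (_ : γ.map Prod.fst = P ∧ γ.map Prod.snd = Q),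
    γ {p : E × E | p.1 ≠ p.2}

open ProbabilityTheory

/-- The mass of an open set is weakly lower semicontinuous. -/
lemma lowerSemicontinuous_measure_of_isOpen {X : Type*} [MeasurableSpace X]
    [TopologicalSpace X] [OpensMeasurableSpace X] [HasOuterApproxClosed X] {U : Set X}
    (hU : IsOpen U) :
    LowerSemicontinuous fun μ : ProbabilityMeasure X ↦ (μ : Measure X) U := by
  rw [lowerSemicontinuous_iff_le_liminf]
  exact fun μ ↦ ProbabilityMeasure.le_liminf_measure_open_of_tendsto Filter.tendsto_id hU

section Couplings

variable {X Y W : Type*} [MeasurableSpace X] [MeasurableSpace Y] [MeasurableSpace W]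

section Polish

variable [TopologicalSpace X] [PolishSpace X] [BorelSpace X]
  [TopologicalSpace Y] [PolishSpace Y] [BorelSpace Y]

/-- The set of couplings of two finite measures on Polish spaces is tight. -/
lemma isTightMeasureSet_couplings (P : Measure X) (Q : Measure Y)
    [IsFiniteMeasure P] [IsFiniteMeasure Q] :
    IsTightMeasureSet {γ : Measure (X × Y) | γ.map Prod.fst = P ∧ γ.map Prod.snd = Q} := by
  rw [isTightMeasureSet_iff_exists_isCompact_measure_compl_le]
  intro ε hε
  have hε2 : 0 < ε / 2 := ENNReal.half_pos hε.ne'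
  obtain ⟨K, hK, hPK⟩ := isTightMeasureSet_iff_exists_isCompact_measure_compl_le.1
    (isTightMeasureSet_singleton (μ := P)) _ hε2
  obtain ⟨L, hL, hQL⟩ := isTightMeasureSet_iff_exists_isCompact_measure_compl_le.1
    (isTightMeasureSet_singleton (μ := Q)) _ hε2
  refine ⟨K ×ˢ L, hK.prod hL, ?_⟩
  rintro γ ⟨rfl, rfl⟩
  calc γ (K ×ˢ L)ᶜ ≤ γ (Prod.fst ⁻¹' Kᶜ ∪ Prod.snd ⁻¹' Lᶜ) := by
        refine measure_mono fun p hp ↦ ?_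
        by_contra h
        simp_all
    _ ≤ γ (Prod.fst ⁻¹' Kᶜ) + γ (Prod.snd ⁻¹' Lᶜ) := measure_union_le _ _
    _ ≤ ε / 2 + ε / 2 := by
        rw [← Measure.map_apply measurable_fst hK.measurableSet.compl,
          ← Measure.map_apply measurable_snd hL.measurableSet.compl]
        exact add_le_add (hPK _ rfl) (hQL _ rfl)
    _ = ε := ENNReal.add_halves ε

/-- The couplings of two probability measures on Polish spaces form a weakly compact set. -/
lemma isCompact_couplings (P : ProbabilityMeasure X) (Q : ProbabilityMeasure Y) :
    IsCompact {γ : ProbabilityMeasure (X × Y) |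
      γ.map measurable_fst.aemeasurable = P ∧ γ.map measurable_snd.aemeasurable = Q} := by
  have hclosed : IsClosed {γ : ProbabilityMeasure (X × Y) |
      γ.map measurable_fst.aemeasurable = P ∧ γ.map measurable_snd.aemeasurable = Q} :=
    (isClosed_singleton.preimage (ProbabilityMeasure.continuous_map continuous_fst)).inter
      (isClosed_singleton.preimage (ProbabilityMeasure.continuous_map continuous_snd))
  rw [← hclosed.closure_eq]
  refine isCompact_closure_of_isTightMeasureSet
    ((isTightMeasureSet_couplings (P : Measure X) (Q : Measure Y)).subset ?_)
  rintro _ ⟨γ, ⟨rfl, rfl⟩, rfl⟩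
  simp

/-- The infimum over all couplings of the mass of an open set is attained. -/
lemma exists_coupling_measure_eq_iInf (P : Measure X) (Q : Measure Y)
    [IsProbabilityMeasure P] [IsProbabilityMeasure Q] {U : Set (X × Y)} (hU : IsOpen U) :
    ∃ γ : Measure (X × Y), (γ.map Prod.fst = P ∧ γ.map Prod.snd = Q) ∧
      γ U = ⨅ (γ' : Measure (X × Y)) (_ : γ'.map Prod.fst = P ∧ γ'.map Prod.snd = Q), γ' U := by
  obtain ⟨γ, ⟨hγP, hγQ⟩, hmin⟩ := LowerSemicontinuousOn.exists_isMinOn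
    (s := {γ : ProbabilityMeasure (X × Y) |
      γ.map measurable_fst.aemeasurable = (⟨P, inferInstance⟩ : ProbabilityMeasure X) ∧
      γ.map measurable_snd.aemeasurable = (⟨Q, inferInstance⟩ : ProbabilityMeasure Y)})
    ⟨⟨P.prod Q, inferInstance⟩, Subtype.ext measurePreserving_fst.map_eq,
      Subtype.ext measurePreserving_snd.map_eq⟩
    (isCompact_couplings _ _) ((lowerSemicontinuous_measure_of_isOpen hU).lowerSemicontinuousOn _)
  have hγ : (γ : Measure (X × Y)).map Prod.fst = P ∧ (γ : Measure (X × Y)).map Prod.snd = Q :=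
    ⟨congrArg Subtype.val hγP, congrArg Subtype.val hγQ⟩
  refine ⟨γ, hγ, le_antisymm (le_iInf₂ fun γ' hγ' ↦ ?_) (iInf₂_le (γ : Measure (X × Y)) hγ)⟩
  have : IsProbabilityMeasure (γ'.map Prod.fst) := hγ'.1 ▸ inferInstance
  have hprob : IsProbabilityMeasure γ' :=
    Measure.isProbabilityMeasure_of_map Prod.fst
  exact hmin (a := ⟨γ', hprob⟩) ⟨Subtype.ext hγ'.1, Subtype.ext hγ'.2⟩

end Polish

/-- Gluing lemma: couplings `γ₁` on `X × Y` and `γ₂` on `Y × W` with the same `Y`-marginal are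
the marginals of a measure on `(X × Y) × W`. -/
lemma exists_gluing [StandardBorelSpace W] [Nonempty W]
    (γ₁ : Measure (X × Y)) (γ₂ : Measure (Y × W)) [IsFiniteMeasure γ₁] [IsFiniteMeasure γ₂]
    (h : γ₁.map Prod.snd = γ₂.map Prod.fst) :
    ∃ π : Measure ((X × Y) × W), π.map Prod.fst = γ₁ ∧
      π.map (fun t ↦ (t.1.2, t.2)) = γ₂ := by
  refine ⟨γ₁ ⊗ₘ γ₂.condKernel.comap Prod.snd measurable_snd, Measure.fst_compProd _ _, ?_⟩
  have hf : Measurable fun t : (X × Y) × W ↦ (t.1.2, t.2) := by fun_prop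
  ext s hs
  rw [Measure.map_apply hf hs, Measure.compProd_apply (hf hs)]
  conv_rhs => rw [← γ₂.disintegrate γ₂.condKernel, Measure.compProd_apply hs, Measure.fst, ← h,
    lintegral_map (Kernel.measurable_kernel_prodMk_left hs) measurable_snd]
  rfl

end Couplings

section LevyProkhorov

lemma isOpen_setOf_lt_norm_sub {E : Type*} [NormedAddCommGroup E] (ε : ℝ) :
    IsOpen {p : E × E | ε < ‖p.1 - p.2‖} :=
  isOpen_lt continuous_const (by fun_prop)

variable {E : Type*} [NormedAddCommGroup E] [MeasurableSpace E] [BorelSpace E]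
  [SecondCountableTopology E]

/-- Moving only the mass displaced by at most `ε` splits a coupling `γ` into a local perturbation
of size `ε` and a total variation perturbation of size `γ {ε < ‖z₁ - z₂‖}`. -/
lemma exists_LPdist_eq_zero_TVdist_le_of_coupling {P Q : Measure E} [IsProbabilityMeasure P]
    {ε : ℝ} (hε : 0 ≤ ε) (γ : Measure (E × E))
    (hγ : γ.map Prod.fst = P ∧ γ.map Prod.snd = Q) :
    ∃ R : Measure E, IsProbabilityMeasure R ∧ LPdist ε P R = 0 ∧
      TVdist R Q ≤ γ {p : E × E | ε < ‖p.1 - p.2‖} := by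
  classical
  obtain ⟨rfl, rfl⟩ := hγ
  have : IsProbabilityMeasure γ := Measure.isProbabilityMeasure_of_map Prod.fst
  set U := {p : E × E | ε < ‖p.1 - p.2‖}
  have hU : MeasurableSet U := (isOpen_setOf_lt_norm_sub ε).measurableSet
  set f : E × E → E := U.piecewise Prod.fst Prod.snd
  have hf : Measurable f := Measurable.piecewise hU measurable_fst measurable_snd
  refine ⟨γ.map f, Measure.isProbabilityMeasure_map hf.aemeasurable,
    le_antisymm ?_ zero_le, ?_⟩
  · have hg : Measurable fun p : E × E ↦ (p.1, f p) := measurable_fst.prodMk hf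
    refine (iInf₂_le (γ.map fun p ↦ (p.1, f p)) ⟨?_, ?_⟩).trans ?_
    · rw [Measure.map_apply hg hU]
      refine (measure_mono_null (fun p hp ↦ ?_) measure_empty).le
      change ε < ‖p.1 - f p‖ at hp
      by_cases hpU : p ∈ U
      · simp [f, hpU, hε.not_gt] at hp
      · rw [show f p = p.2 by simp [f, hpU]] at hp
        exact hpU hp
    · rw [Measure.map_map measurable_fst hg]; rfl
    · rw [Measure.map_map measurable_snd hg]; rfl
  · have hg : Measurable fun p : E × E ↦ (f p, p.2) := hf.prodMk measurable_snd
    refine (iInf₂_le (γ.map fun p ↦ (f p, p.2)) ⟨?_, ?_⟩).trans ?_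
    · have hD : MeasurableSet {p : E × E | p.1 ≠ p.2} :=
        (isOpen_ne_fun continuous_fst continuous_snd).measurableSet
      rw [Measure.map_apply hg hD]
      refine measure_mono fun p hp ↦ ?_
      by_contra hpU
      simp [f, hpU] at hp
    · rw [Measure.map_map measurable_fst hg]; rfl
    · rw [Measure.map_map measurable_snd hg]; rfl

/-- The Lévy–Prokhorov and total variation discrepancies satisfy a mixed triangle inequality. -/
lemma LPdist_le_LPdist_add_TVdist [CompleteSpace E] (P R Q : Measure E)
    [IsProbabilityMeasure P] [IsProbabilityMeasure R] [IsProbabilityMeasure Q] (ε : ℝ) :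
    LPdist ε P Q ≤ LPdist ε P R + TVdist R Q := by
  have hU := isOpen_setOf_lt_norm_sub (E := E) ε
  have hD : IsOpen {p : E × E | p.1 ≠ p.2} := isOpen_ne_fun continuous_fst continuous_snd
  obtain ⟨γ₁, ⟨hP, hR₁⟩, h₁⟩ := exists_coupling_measure_eq_iInf P R hU
  obtain ⟨γ₂, ⟨hR₂, hQ⟩, h₂⟩ := exists_coupling_measure_eq_iInf R Q hD
  rw [LPdist, LPdist, TVdist, ← h₁, ← h₂]
  have : IsProbabilityMeasure (γ₁.map Prod.fst) := hP ▸ inferInstance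
  have : IsProbabilityMeasure γ₁ := Measure.isProbabilityMeasure_of_map Prod.fst
  have : IsProbabilityMeasure (γ₂.map Prod.fst) := hR₂ ▸ inferInstance
  have : IsProbabilityMeasure γ₂ := Measure.isProbabilityMeasure_of_map Prod.fst
  obtain ⟨π, hπ₁, hπ₂⟩ := exists_gluing γ₁ γ₂ (hR₁.trans hR₂.symm)
  have hf : Measurable fun t : (E × E) × E ↦ (t.1.2, t.2) := by fun_prop
  have hg : Measurable fun t : (E × E) × E ↦ (t.1.1, t.2) := by fun_prop
  refine (iInf₂_le (π.map fun t ↦ (t.1.1, t.2)) ⟨?_, ?_⟩).trans ?_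
  · rw [← hπ₁, ← hπ₂, Measure.map_apply hg hU.measurableSet,
      Measure.map_apply measurable_fst hU.measurableSet, Measure.map_apply hf hD.measurableSet]
    refine (measure_mono fun t ht ↦ ?_).trans (measure_union_le _ _)
    by_cases h : t.1.2 = t.2
    · left
      simpa [h] using ht
    · exact Or.inr h
  · rw [Measure.map_map measurable_fst hg, ← hP, ← hπ₁,
      Measure.map_map measurable_fst measurable_fst]
    rfl
  · rw [Measure.map_map measurable_snd hg, ← hQ, ← hπ₂, Measure.map_map measurable_snd hf]
    rfl

end LevyProkhorov

/-- Decomposition of the LP ambiguity set: `Q ∈ B_{ε,ρ}(P)` iff `Q` is obtained from `P`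
by a local `∞`-Wasserstein perturbation of size `ε` (i.e. `LP_ε(P,P̃) = 0`) followed by a
global total-variation perturbation of size `ρ`. -/
theorem lp_ball_decomposition {Z : Type*} [NormedAddCommGroup Z] [NormedSpace ℝ Z]
    [FiniteDimensional ℝ Z] [MeasurableSpace Z] [BorelSpace Z]
    (P Q : Measure Z) [IsProbabilityMeasure P] [IsProbabilityMeasure Q]
    (ε ρ : ℝ) (hε : 0 ≤ ε) (hρ0 : 0 ≤ ρ) (hρ1 : ρ ≤ 1) :
    LPdist ε P Q ≤ ENNReal.ofReal ρ ↔
      ∃ Ptilde : Measure Z, IsProbabilityMeasure Ptilde ∧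
        LPdist ε P Ptilde = 0 ∧ TVdist Ptilde Q ≤ ENNReal.ofReal ρ := by
  have : ProperSpace Z := FiniteDimensional.proper_real Z
  constructor
  · intro h
    obtain ⟨γ, hγ, hmin⟩ := exists_coupling_measure_eq_iInf P Q (isOpen_setOf_lt_norm_sub ε)
    obtain ⟨R, hR, hLP, hTV⟩ := exists_LPdist_eq_zero_TVdist_le_of_coupling hε γ hγ
    exact ⟨R, hR, hLP, hTV.trans (hmin.le.trans h)⟩
  · rintro ⟨R, hR, hLP, hTV⟩
    calc LPdist ε P Q ≤ LPdist ε P R + TVdist R Q := LPdist_le_LPdist_add_TVdist P R Q ε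
      _ ≤ ENNReal.ofReal ρ := by rwa [hLP, zero_add]
end

section
/- Let P, Q be Borel probability measures on Z, let ε ≥ 0 and ρ ∈ [0,1]. Then LP_ε(P,Q) ≤ ρ if and only if there exist a probability space (Ω, 𝔉, ℙ) and measurable random variables Z₁ : Ω → Z, N : Ω → Z, B : Ω → {0,1}, C : Ω → Z (allowed to be arbitrarily dependent) such that: Z₁ has law P; ‖N‖ ≤ ε holds ℙ-almost surely; ℙ(B = 1) ≤ ρ; and the random variable Z₂ := (Z₁ + N)·𝟙{B = 0} + C·𝟙{B = 1} has law Q. (Local-and-global perturbation characterization of the LP ambiguity set.) -/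
open MeasureTheory

open Filter Topology

/-- The mass of an open set is a lower semicontinuous function of the probability measure. -/
theorem lowerSemicontinuous_probabilityMeasure_apply_of_isOpen {X : Type*} [TopologicalSpace X]
    [MeasurableSpace X] [OpensMeasurableSpace X] [HasOuterApproxClosed X] {U : Set X}
    (hU : IsOpen U) :
    LowerSemicontinuous fun μ : ProbabilityMeasure X => (μ : Measure X) U :=
  lowerSemicontinuous_iff_le_liminf.2 fun _ =>
    ProbabilityMeasure.le_liminf_measure_open_of_tendsto tendsto_id hU

/-- The couplings of two probability measures on a Polish space form a compact set. -/
theorem isCompact_couplings_s4 {X : Type*} [TopologicalSpace X] [PolishSpace X]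
    [MeasurableSpace X] [BorelSpace X] (P Q : Measure X) [IsProbabilityMeasure P]
    [IsProbabilityMeasure Q] :
    IsCompact {γ : ProbabilityMeasure (X × X) |
      (γ : Measure (X × X)).map Prod.fst = P ∧ (γ : Measure (X × X)).map Prod.snd = Q} := by
  set S := {γ : ProbabilityMeasure (X × X) |
      (γ : Measure (X × X)).map Prod.fst = P ∧ (γ : Measure (X × X)).map Prod.snd = Q}
  have tight : IsTightMeasureSet {((μ : ProbabilityMeasure (X × X)) : Measure (X × X)) | μ ∈ S} := by
    apply IsTightMeasureSet.prodMk
    · refine (isTightMeasureSet_singleton (μ := P)).subset ?_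
      rintro _ ⟨_, ⟨γ, hγ, rfl⟩, rfl⟩
      exact hγ.1
    · refine (isTightMeasureSet_singleton (μ := Q)).subset ?_
      rintro _ ⟨_, ⟨γ, hγ, rfl⟩, rfl⟩
      exact hγ.2
  have closed : IsClosed S := by
    let := TopologicalSpace.upgradeIsCompletelyMetrizable X
    let P' : ProbabilityMeasure X := ⟨P, inferInstance⟩
    let Q' : ProbabilityMeasure X := ⟨Q, inferInstance⟩
    have h₁ := (isClosed_singleton (x := P')).preimage
      (ProbabilityMeasure.continuous_map (Ω := X × X) continuous_fst)
    have h₂ := (isClosed_singleton (x := Q')).preimage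
      (ProbabilityMeasure.continuous_map (Ω := X × X) continuous_snd)
    convert h₁.inter h₂ using 1
    ext γ
    exact ⟨fun h => ⟨Subtype.ext h.1, Subtype.ext h.2⟩,
      fun h => ⟨congrArg Subtype.val h.1, congrArg Subtype.val h.2⟩⟩
  exact closed.closure_eq ▸ isCompact_closure_of_isTightMeasureSet tight

/-- The infimum defining the Lévy–Prokhorov discrepancy is attained. -/
theorem exists_coupling_eq_LPdist {E : Type*} [NormedAddCommGroup E] [CompleteSpace E]
    [SecondCountableTopology E] [MeasurableSpace E] [BorelSpace E] (ε : ℝ) (P Q : Measure E)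
    [IsProbabilityMeasure P] [IsProbabilityMeasure Q] :
    ∃ γ : Measure (E × E), IsProbabilityMeasure γ ∧ γ.map Prod.fst = P ∧ γ.map Prod.snd = Q ∧
      γ {p : E × E | ε < ‖p.1 - p.2‖} = LPdist ε P Q := by
  have hU : IsOpen {p : E × E | ε < ‖p.1 - p.2‖} :=
    isOpen_lt continuous_const (by fun_prop)
  obtain ⟨γ, hγ, hmin⟩ := LowerSemicontinuousOn.exists_isMinOn
    (s := {γ : ProbabilityMeasure (E × E) |
      (γ : Measure (E × E)).map Prod.fst = P ∧ (γ : Measure (E × E)).map Prod.snd = Q})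
    ⟨⟨P.prod Q, inferInstance⟩, by simp [Measure.map_fst_prod], by simp [Measure.map_snd_prod]⟩
    (isCompact_couplings_s4 P Q)
    ((lowerSemicontinuous_probabilityMeasure_apply_of_isOpen hU).lowerSemicontinuousOn _)
  refine ⟨γ, inferInstance, hγ.1, hγ.2,
    le_antisymm (le_iInf₂ fun η hη => ?_) (iInf₂_le (γ : Measure (E × E)) hγ)⟩
  have : IsProbabilityMeasure (η.map Prod.fst) := hη.1.symm ▸ inferInstance
  have : IsProbabilityMeasure η := Measure.isProbabilityMeasure_of_map Prod.fst
  exact isMinOn_iff.1 hmin ⟨η, this⟩ hη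

/-- Local-and-global perturbation characterization of the LP ambiguity set:
`LP_ε(P,Q) ≤ ρ` iff on some probability space there are (possibly dependent) random
variables `Z₁ ~ P`, a local perturbation `N` with `‖N‖ ≤ ε` a.s., a Bernoulli indicator `B`
with `ℙ(B = 1) ≤ ρ`, and a global perturbation `C`, such that
`Z₂ := (Z₁ + N)·𝟙{B = 0} + C·𝟙{B = 1}` has law `Q`. -/
theorem lp_ball_local_global {Z : Type} [NormedAddCommGroup Z] [NormedSpace ℝ Z]
    [FiniteDimensional ℝ Z] [MeasurableSpace Z] [BorelSpace Z]
    (P Q : Measure Z) [IsProbabilityMeasure P] [IsProbabilityMeasure Q]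
    (ε ρ : ℝ) (hε : 0 ≤ ε) (hρ0 : 0 ≤ ρ) (hρ1 : ρ ≤ 1) :
    LPdist ε P Q ≤ ENNReal.ofReal ρ ↔
      ∃ (Ω : Type) (_ : MeasurableSpace Ω) (ℙ : Measure Ω),
        IsProbabilityMeasure ℙ ∧
        ∃ (Z₁ N C : Ω → Z) (B : Ω → Bool),
          Measurable Z₁ ∧ Measurable N ∧ Measurable C ∧ Measurable B ∧
          ℙ.map Z₁ = P ∧
          (∀ᵐ ω ∂ℙ, ‖N ω‖ ≤ ε) ∧
          ℙ {ω | B ω = true} ≤ ENNReal.ofReal ρ ∧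
          ℙ.map (fun ω => if B ω = true then C ω else Z₁ ω + N ω) = Q := by
  have := FiniteDimensional.proper_real Z
  have hsep : MeasurableSet {p : Z × Z | ε < ‖p.1 - p.2‖} :=
    measurableSet_lt measurable_const (by fun_prop)
  constructor
  · intro h
    obtain ⟨γ, hγ, hP, hQ, hmass⟩ := exists_coupling_eq_LPdist ε P Q
    classical
    refine ⟨Z × Z, inferInstance, γ, hγ, Prod.fst,
      fun p => if ε < ‖p.1 - p.2‖ then 0 else p.2 - p.1, Prod.snd,
      fun p => decide (ε < ‖p.1 - p.2‖), measurable_fst,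
      Measurable.ite hsep measurable_const (by fun_prop), measurable_snd,
      measurable_to_bool (by simpa [Set.preimage] using hsep), hP,
      ae_of_all _ fun p => ?_, by simpa [hmass] using h, ?_⟩
    · dsimp only
      split_ifs with hp
      · simpa using hε
      · rw [norm_sub_rev]
        exact not_lt.1 hp
    · rw [← hQ]
      congr 1
      ext p
      by_cases hp : ε < ‖p.1 - p.2‖ <;> simp [hp]
  · rintro ⟨Ω, _, ℙ, _, Z₁, N, C, B, hZ₁, hN, hC, hB, hP, hNε, hBρ, hQ⟩
    have hZ₂ : Measurable fun ω => if B ω = true then C ω else Z₁ ω + N ω :=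
      Measurable.ite (hB (measurableSet_singleton true)) hC (hZ₁.add hN)
    have hpair := hZ₁.prodMk hZ₂
    refine (iInf₂_le (ℙ.map fun ω => (Z₁ ω, if B ω = true then C ω else Z₁ ω + N ω))
      (And.intro ?fst ?snd)).trans (le_trans ?mass hBρ)
    case fst =>
      rw [Measure.map_map measurable_fst hpair]
      exact hP
    case snd =>
      rw [Measure.map_map measurable_snd hpair]
      exact hQ
    case mass =>
      rw [Measure.map_apply hpair hsep]
      refine measure_mono_ae (hNε.mono fun ω hω hmem => ?_)
      by_contra hB_mem
      have hBω : ¬B ω = true := hB_mem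
      have hlt : ε < ‖Z₁ ω - if B ω = true then C ω else Z₁ ω + N ω‖ := hmem
      rw [if_neg hBω, sub_add_cancel_left, norm_neg] at hlt
      exact hlt.not_ge hω
end

section
/- Let s : Z → ℝ be k-Lipschitz for some k ≥ 0, let P be a Borel probability measure on Z, let ε ≥ 0 and ρ ∈ [0,1]. Then the pushforward of the LP ambiguity set is contained in an LP ambiguity set around the pushforward: s_# B_{ε,ρ}(P) ⊆ B_{kε,ρ}(s_# P); that is, for every Borel probability measure Q on Z with LP_ε(P,Q) ≤ ρ, one has LP_{kε}(s_# P, s_# Q) ≤ ρ, where on ℝ the LP discrepancy is defined with the absolute-value metric. (Propagation of the LP ambiguity set through a Lipschitz scoring function.) -/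
open MeasureTheory

theorem LPdist_map_le {E F : Type*} [NormedAddCommGroup E] [MeasurableSpace E] [BorelSpace E]
    [NormedAddCommGroup F] [MeasurableSpace F] [BorelSpace F] [SecondCountableTopology F]
    {f : E → F} {k : NNReal} (hf : LipschitzWith k f) (ε : ℝ) (P Q : Measure E) :
    LPdist ((k : ℝ) * ε) (P.map f) (Q.map f) ≤ LPdist ε P Q := by
  have hfm : Measurable f := hf.continuous.measurable
  refine le_iInf₂ fun γ ⟨hP, hQ⟩ => ?_
  have hff : Measurable (Prod.map f f) := hfm.prodMap hfm
  have hfst : (γ.map (Prod.map f f)).map Prod.fst = P.map f := by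
    rw [Measure.map_map measurable_fst hff, ← hP, Measure.map_map hfm measurable_fst]
    rfl
  have hsnd : (γ.map (Prod.map f f)).map Prod.snd = Q.map f := by
    rw [Measure.map_map measurable_snd hff, ← hQ, Measure.map_map hfm measurable_snd]
    rfl
  have hms : MeasurableSet {p : F × F | (k : ℝ) * ε < ‖p.1 - p.2‖} :=
    measurableSet_lt measurable_const (measurable_fst.sub measurable_snd).norm
  refine (iInf₂_le (γ.map (Prod.map f f)) ⟨hfst, hsnd⟩).trans ?_
  rw [Measure.map_apply hff hms]
  refine measure_mono fun p (hp : (k : ℝ) * ε < ‖f p.1 - f p.2‖) => ?_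
  exact lt_of_mul_lt_mul_left (hp.trans_le (hf.norm_sub_le p.1 p.2)) k.coe_nonneg

/-- Propagation of the LP ambiguity set through a `k`-Lipschitz scoring function:
`s_# B_{ε,ρ}(P) ⊆ B_{kε,ρ}(s_# P)`, i.e. `LP_ε(P,Q) ≤ ρ` implies
`LP_{kε}(s_# P, s_# Q) ≤ ρ`. -/
theorem lp_ball_pushforward {Z : Type*} [NormedAddCommGroup Z] [NormedSpace ℝ Z]
    [FiniteDimensional ℝ Z] [MeasurableSpace Z] [BorelSpace Z]
    (s : Z → ℝ) (k : NNReal) (hs : LipschitzWith k s)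
    (P : Measure Z) [IsProbabilityMeasure P]
    (ε ρ : ℝ) (hε : 0 ≤ ε) (hρ0 : 0 ≤ ρ) (hρ1 : ρ ≤ 1) :
    ∀ Q : Measure Z, IsProbabilityMeasure Q → LPdist ε P Q ≤ ENNReal.ofReal ρ →
      LPdist ((k : ℝ) * ε) (P.map s) (Q.map s) ≤ ENNReal.ofReal ρ := by
  exact fun Q _ hQ => (LPdist_map_le hs ε P Q).trans hQ
end

section
/- Let P be a Borel probability measure on ℝ, let ε ≥ 0, β ∈ (0,1), and ρ ∈ [0, 1−β) (so that β + ρ < 1). Then the worst-case β-quantile over the LP ambiguity set satisfies sup_{Q : LP_ε(P,Q) ≤ ρ} Quant(β; Q) = Quant(β + ρ; P) + ε. -/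
open MeasureTheory

/-- The CDF of a measure on `ℝ`: `F_μ(s) = μ((-∞, s])`. -/
noncomputable def cdf (μ : Measure ℝ) (s : ℝ) : ℝ := (μ (Set.Iic s)).toReal

/-- The `α`-quantile of a measure on `ℝ`: `Quant(α; μ) = inf {s : F_μ(s) ≥ α}`. -/
noncomputable def Quant (α : ℝ) (μ : Measure ℝ) : ℝ := sInf {s : ℝ | α ≤ cdf μ s}

theorem cdf_eq_probabilityTheory_cdf (μ : Measure ℝ) [IsProbabilityMeasure μ] (s : ℝ) :
    cdf μ s = ProbabilityTheory.cdf μ s :=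
  (ProbabilityTheory.cdf_eq_real μ s).symm

theorem nonempty_setOf_le_cdf (μ : Measure ℝ) [IsProbabilityMeasure μ] {α : ℝ} (hα : α < 1) :
    {s : ℝ | α ≤ cdf μ s}.Nonempty := by
  obtain ⟨s, hs⟩ := ((ProbabilityTheory.tendsto_cdf_atTop μ).eventually_const_le hα).exists
  exact ⟨s, by simpa [cdf_eq_probabilityTheory_cdf] using hs⟩

theorem bddBelow_setOf_le_cdf (μ : Measure ℝ) [IsProbabilityMeasure μ] {α : ℝ} (hα : 0 < α) :
    BddBelow {s : ℝ | α ≤ cdf μ s} := by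
  obtain ⟨b, hb⟩ := ((ProbabilityTheory.tendsto_cdf_atBot μ).eventually_lt_const hα).exists
  refine ⟨b, fun s hs => le_of_not_gt fun hsb => ?_⟩
  rw [Set.mem_ofPred_eq, cdf_eq_probabilityTheory_cdf] at hs
  exact absurd (hs.trans (ProbabilityTheory.monotone_cdf μ hsb.le)) (not_le.mpr hb)

theorem cdf_lt_of_lt_Quant (μ : Measure ℝ) [IsProbabilityMeasure μ] {α t : ℝ} (hα : 0 < α)
    (ht : t < Quant α μ) : cdf μ t < α :=
  not_le.mp (notMem_of_lt_csInf (s := {s : ℝ | α ≤ cdf μ s}) ht (bddBelow_setOf_le_cdf μ hα))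

theorem measure_Iio_Quant_le (μ : Measure ℝ) [IsProbabilityMeasure μ] {α : ℝ} (hα : 0 < α) :
    μ (Set.Iio (Quant α μ)) ≤ ENNReal.ofReal α := by
  obtain ⟨u, hu, hlt, htend⟩ := exists_seq_strictMono_tendsto (Quant α μ)
  rw [← iUnion_Iic_eq_Iio_of_lt_of_tendsto hlt htend,
    Monotone.measure_iUnion fun i j hij => Set.Iic_subset_Iic.mpr (hu.monotone hij)]
  exact iSup_le fun n => ENNReal.le_ofReal_iff_toReal_le (measure_ne_top _ _) hα.le |>.mpr
    (cdf_lt_of_lt_Quant μ hα (hlt n)).le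

/-- Up to the Lévy–Prokhorov discrepancy, mass to the left of `t` stays to the left of `t + ε`. -/
theorem measure_Iic_le_add_LPdist (ε t : ℝ) (P Q : Measure ℝ) :
    P (Set.Iic t) ≤ Q (Set.Iic (t + ε)) + LPdist ε P Q := by
  rw [← tsub_le_iff_left]
  refine le_iInf₂ fun γ hγ => ?_
  rw [tsub_le_iff_left, ← hγ.1, ← hγ.2, Measure.map_apply measurable_fst measurableSet_Iic,
    Measure.map_apply measurable_snd measurableSet_Iic]
  refine (measure_mono fun p hp => ?_).trans (measure_union_le _ _)
  by_cases h : ε < ‖p.1 - p.2‖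
  · exact Or.inr h
  · left
    have h₁ := (abs_le.mp (not_lt.mp h)).1
    have h₂ : p.1 ≤ t := hp
    change p.2 ≤ t + ε
    linarith

theorem cdf_le_cdf_add_of_LPdist_le {ε ρ : ℝ} (t : ℝ) (hρ : 0 ≤ ρ) (P Q : Measure ℝ)
    [IsProbabilityMeasure Q] (h : LPdist ε P Q ≤ ENNReal.ofReal ρ) :
    cdf P t ≤ cdf Q (t + ε) + ρ := by
  have h₁ := (measure_Iic_le_add_LPdist ε t P Q).trans (add_le_add_right h _)
  have h₂ := ENNReal.toReal_mono (by finiteness) h₁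
  rwa [ENNReal.toReal_add (by finiteness) (by finiteness), ENNReal.toReal_ofReal hρ] at h₂

theorem Quant_le_of_LPdist_le {ε β ρ : ℝ} (hβ : 0 < β) (hρ : 0 ≤ ρ) (hβρ : β + ρ < 1)
    (P Q : Measure ℝ) [IsProbabilityMeasure P] [IsProbabilityMeasure Q]
    (h : LPdist ε P Q ≤ ENNReal.ofReal ρ) : Quant β Q ≤ Quant (β + ρ) P + ε := by
  rw [← sub_le_iff_le_add]
  refine le_csInf (nonempty_setOf_le_cdf P hβρ) fun t ht => ?_
  rw [sub_le_iff_le_add]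
  refine csInf_le (bddBelow_setOf_le_cdf Q hβ) ?_
  have h₁ := cdf_le_cdf_add_of_LPdist_le t hρ P Q h
  rw [Set.mem_ofPred_eq] at ht ⊢
  linarith

/-- Shift `P` to the right by `ε`, after moving the proportion `c` of the mass left of `s` to `s`. -/
noncomputable def shiftedMixture (P : Measure ℝ) (ε s c : ℝ) : Measure ℝ :=
  ENNReal.ofReal c • P.map (fun x => max x s + ε) + ENNReal.ofReal (1 - c) • P.map (fun x => x + ε)

theorem ofReal_add_ofReal_one_sub {c : ℝ} (hc₀ : 0 ≤ c) (hc₁ : c ≤ 1) :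
    ENNReal.ofReal c + ENNReal.ofReal (1 - c) = 1 := by
  rw [← ENNReal.ofReal_add hc₀ (sub_nonneg.mpr hc₁), add_sub_cancel, ENNReal.ofReal_one]

theorem isProbabilityMeasure_shiftedMixture (P : Measure ℝ) [IsProbabilityMeasure P] (ε s : ℝ)
    {c : ℝ} (hc₀ : 0 ≤ c) (hc₁ : c ≤ 1) : IsProbabilityMeasure (shiftedMixture P ε s c) := by
  constructor
  have h₁ : Measurable fun x : ℝ => max x s + ε := by fun_prop
  have h₂ : Measurable fun x : ℝ => x + ε := by fun_prop
  simp [shiftedMixture, Measure.map_apply h₁, Measure.map_apply h₂,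
    ofReal_add_ofReal_one_sub hc₀ hc₁]

theorem LPdist_shiftedMixture_le (P : Measure ℝ) {ε c : ℝ} (s : ℝ) (hε : 0 ≤ ε)
    (hc₀ : 0 ≤ c) (hc₁ : c ≤ 1) :
    LPdist ε P (shiftedMixture P ε s c) ≤ ENNReal.ofReal c * P (Set.Iio s) := by
  have h₁ : Measurable fun x : ℝ => (x, max x s + ε) := by fun_prop
  have h₂ : Measurable fun x : ℝ => (x, x + ε) := by fun_prop
  have hS : MeasurableSet {p : ℝ × ℝ | ε < ‖p.1 - p.2‖} :=
    measurableSet_lt (by fun_prop) (by fun_prop)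
  refine (iInf₂_le (ENNReal.ofReal c • P.map (fun x => (x, max x s + ε)) +
    ENNReal.ofReal (1 - c) • P.map (fun x => (x, x + ε))) ⟨?_, ?_⟩).trans ?_
  · have e₁ : (fun x : ℝ => (x, max x s + ε)) ⁻¹' {p | ε < ‖p.1 - p.2‖} ⊆ Set.Iio s := by
      intro x hx
      by_contra h
      simp [max_eq_left (not_lt.mp (Set.mem_Iio.not.mp h)), abs_of_nonneg hε] at hx
    have e₂ : (fun x : ℝ => (x, x + ε)) ⁻¹' {p | ε < ‖p.1 - p.2‖} = ∅ := by
      ext x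
      simp [abs_of_nonneg hε]
    simp only [Measure.add_apply, Measure.smul_apply, smul_eq_mul, Measure.map_apply h₁ hS,
      Measure.map_apply h₂ hS, e₂, measure_empty, mul_zero, add_zero]
    gcongr
  · rw [Measure.map_add _ _ measurable_fst, Measure.map_smul, Measure.map_smul,
      Measure.map_map measurable_fst h₁, Measure.map_map measurable_fst h₂]
    change ENNReal.ofReal c • P.map id + ENNReal.ofReal (1 - c) • P.map id = P
    rw [← add_smul, ofReal_add_ofReal_one_sub hc₀ hc₁, one_smul, Measure.map_id]
  · rw [Measure.map_add _ _ measurable_snd, Measure.map_smul, Measure.map_smul,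
      Measure.map_map measurable_snd h₁, Measure.map_map measurable_snd h₂]
    rfl

theorem cdf_shiftedMixture_of_lt (P : Measure ℝ) {ε s c u : ℝ} (hc₁ : c ≤ 1) (hu : u < s + ε) :
    cdf (shiftedMixture P ε s c) u = (1 - c) * cdf P (u - ε) := by
  have h₁ : Measurable fun x : ℝ => max x s + ε := by fun_prop
  have h₂ : Measurable fun x : ℝ => x + ε := by fun_prop
  have e₁ : (fun x : ℝ => max x s + ε) ⁻¹' Set.Iic u = ∅ := by
    ext x
    have := le_max_right x s
    simp only [Set.mem_preimage, Set.mem_Iic, Set.mem_empty_iff_false, iff_false, not_le]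
    linarith
  have e₂ : (fun x : ℝ => x + ε) ⁻¹' Set.Iic u = Set.Iic (u - ε) := by
    ext x
    simp [le_sub_iff_add_le]
  simp [cdf, shiftedMixture, Measure.map_apply h₁ measurableSet_Iic,
    Measure.map_apply h₂ measurableSet_Iic, e₁, e₂, ENNReal.toReal_ofReal (sub_nonneg.mpr hc₁)]

theorem le_Quant_shiftedMixture (P : Measure ℝ) [IsProbabilityMeasure P] {β ρ : ℝ} (ε : ℝ)
    (hβ₀ : 0 < β) (hβ₁ : β < 1) (hρ : 0 ≤ ρ) :
    Quant (β + ρ) P + ε ≤ Quant β (shiftedMixture P ε (Quant (β + ρ) P) (ρ / (β + ρ))) := by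
  have hpos : 0 < β + ρ := by positivity
  have hc₁ : ρ / (β + ρ) ≤ 1 := (div_le_one hpos).mpr (by linarith)
  have := isProbabilityMeasure_shiftedMixture P ε (Quant (β + ρ) P) (div_nonneg hρ hpos.le) hc₁
  refine le_csInf (nonempty_setOf_le_cdf _ hβ₁) fun u hu => le_of_not_gt fun hlt => ?_
  rw [Set.mem_ofPred_eq, cdf_shiftedMixture_of_lt P hc₁ hlt] at hu
  have h := cdf_lt_of_lt_Quant P hpos (sub_lt_iff_lt_add.mpr hlt)
  have hc : 1 - ρ / (β + ρ) = β / (β + ρ) := by field_simp; ring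
  rw [hc, div_mul_eq_mul_div, le_div_iff₀ hpos] at hu
  exact absurd (le_of_mul_le_mul_left hu hβ₀) (not_le.mpr h)

/-- Worst-case quantile over the LP ambiguity set:
`sup_{Q : LP_ε(P,Q) ≤ ρ} Quant(β; Q) = Quant(β + ρ; P) + ε`. -/
theorem lp_worst_case_quantile (P : Measure ℝ) [IsProbabilityMeasure P]
    (ε β ρ : ℝ) (hε : 0 ≤ ε) (hβ : β ∈ Set.Ioo (0:ℝ) 1) (hρ0 : 0 ≤ ρ) (hρ : ρ < 1 - β) :
    sSup {x : ℝ | ∃ Q : Measure ℝ, IsProbabilityMeasure Q ∧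
        LPdist ε P Q ≤ ENNReal.ofReal ρ ∧ Quant β Q = x}
      = Quant (β + ρ) P + ε := by
  obtain ⟨hβ₀, hβ₁⟩ := hβ
  have hpos : 0 < β + ρ := by positivity
  have hc₀ : 0 ≤ ρ / (β + ρ) := by positivity
  have hc₁ : ρ / (β + ρ) ≤ 1 := (div_le_one hpos).mpr (by linarith)
  have hub : ∀ Q : Measure ℝ, IsProbabilityMeasure Q → LPdist ε P Q ≤ ENNReal.ofReal ρ →
      Quant β Q ≤ Quant (β + ρ) P + ε :=
    fun Q _ hQ => Quant_le_of_LPdist_le hβ₀ hρ0 (by linarith) P Q hQ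
  have hQ := isProbabilityMeasure_shiftedMixture P ε (Quant (β + ρ) P) hc₀ hc₁
  have hLP : LPdist ε P (shiftedMixture P ε (Quant (β + ρ) P) (ρ / (β + ρ))) ≤
      ENNReal.ofReal ρ := by
    calc _ ≤ ENNReal.ofReal (ρ / (β + ρ)) * P (Set.Iio (Quant (β + ρ) P)) :=
          LPdist_shiftedMixture_le P _ hε hc₀ hc₁
      _ ≤ ENNReal.ofReal (ρ / (β + ρ)) * ENNReal.ofReal (β + ρ) := by
          gcongr
          exact measure_Iio_Quant_le P hpos
      _ = ENNReal.ofReal ρ := by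
          rw [← ENNReal.ofReal_mul hc₀, div_mul_cancel₀ _ hpos.ne']
  refine IsGreatest.csSup_eq ⟨⟨_, hQ, hLP, le_antisymm (hub _ hQ hLP) ?_⟩, ?_⟩
  · exact le_Quant_shiftedMixture P ε hβ₀ hβ₁ hρ0
  · rintro _ ⟨Q, hQ', hQLP, rfl⟩
    exact hub Q hQ' hQLP
end

section
/- Let P be a Borel probability measure on ℝ, let ε ≥ 0, q ∈ ℝ, and ρ ∈ (0,1] with ρ ≤ F_P(q − ε). Then for every δ ∈ (0, ρ] there exists a Borel probability measure Q on ℝ with LP_ε(P,Q) ≤ ρ and F_Q(q) ≤ F_P(q − ε) − ρ + δ. (Attainment, in the limit δ ↓ 0, of the worst-case coverage over the LP ambiguity set.) -/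
open MeasureTheory

/-- The law of `(X, Y)` for `X ∼ P`, where `Y = X + ε` off the half-line `(-∞, q - ε]`, and on that
half-line `Y = X` with weight `c` and `Y = q + 1` with weight `d`. -/
noncomputable def splitCoupling (P : Measure ℝ) (ε q : ℝ) (c d : ENNReal) : Measure (ℝ × ℝ) :=
  (c • P.restrict (Set.Iic (q - ε))).map (fun x => (x, x)) +
    (d • P.restrict (Set.Iic (q - ε))).map (fun x => (x, q + 1)) +
    (P.restrict (Set.Iic (q - ε))ᶜ).map (fun x => (x, x + ε))

lemma splitCoupling_apply (P : Measure ℝ) (ε q : ℝ) (c d : ENNReal) {S : Set (ℝ × ℝ)}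
    (hS : MeasurableSet S) :
    splitCoupling P ε q c d S =
      c * P.restrict (Set.Iic (q - ε)) ((fun x => (x, x)) ⁻¹' S) +
        d * P.restrict (Set.Iic (q - ε)) ((fun x => (x, q + 1)) ⁻¹' S) +
        P.restrict (Set.Iic (q - ε))ᶜ ((fun x => (x, x + ε)) ⁻¹' S) := by
  rw [splitCoupling, Measure.add_apply, Measure.add_apply, Measure.map_apply (by fun_prop) hS,
    Measure.map_apply (by fun_prop) hS, Measure.map_apply (by fun_prop) hS]
  rfl

lemma splitCoupling_map_fst (P : Measure ℝ) (ε q : ℝ) {c d : ENNReal} (hcd : c + d = 1) :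
    (splitCoupling P ε q c d).map Prod.fst = P := by
  ext S hS
  rw [Measure.map_apply measurable_fst hS, splitCoupling_apply P ε q c d (measurable_fst hS)]
  simp only [Set.preimage_preimage, Set.preimage_id']
  rw [← add_mul, hcd, one_mul, ← Measure.add_apply,
    Measure.restrict_add_restrict_compl measurableSet_Iic]

lemma splitCoupling_far_le (P : Measure ℝ) {ε : ℝ} (hε : 0 ≤ ε) (q : ℝ) (c d : ENNReal) :
    splitCoupling P ε q c d {p : ℝ × ℝ | ε < ‖p.1 - p.2‖} ≤ d * P (Set.Iic (q - ε)) := by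
  rw [splitCoupling_apply P ε q c d (measurableSet_lt (by fun_prop) (by fun_prop))]
  have h₁ : (fun x : ℝ => (x, x)) ⁻¹' {p : ℝ × ℝ | ε < ‖p.1 - p.2‖} = ∅ := by
    ext x; simp [hε]
  have h₂ : (fun x : ℝ => (x, x + ε)) ⁻¹' {p : ℝ × ℝ | ε < ‖p.1 - p.2‖} = ∅ := by
    ext x; simp [abs_of_nonneg hε]
  rw [h₁, h₂, measure_empty, measure_empty, mul_zero, zero_add, add_zero]
  gcongr d * ?_
  exact (measure_mono (Set.subset_univ _)).trans_eq (Measure.restrict_apply_univ _)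

lemma splitCoupling_map_snd_Iic_le (P : Measure ℝ) (ε q : ℝ) (c d : ENNReal) :
    (splitCoupling P ε q c d).map Prod.snd (Set.Iic q) ≤ c * P (Set.Iic (q - ε)) := by
  rw [Measure.map_apply measurable_snd measurableSet_Iic,
    splitCoupling_apply P ε q c d (measurable_snd measurableSet_Iic)]
  simp only [Set.preimage_preimage, Set.preimage_id']
  have h₁ : (fun _ : ℝ => q + 1) ⁻¹' Set.Iic q = ∅ := by
    ext x; simp
  have h₂ : (fun x : ℝ => x + ε) ⁻¹' Set.Iic q = Set.Iic (q - ε) := by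
    ext x; simp [le_sub_iff_add_le]
  rw [h₁, h₂, Measure.restrict_apply (s := (Set.Iic (q - ε))ᶜ) measurableSet_Iic,
    Set.inter_compl_self, measure_empty, measure_empty, mul_zero, add_zero, add_zero]
  gcongr c * ?_
  exact (measure_mono (Set.subset_univ _)).trans_eq (Measure.restrict_apply_univ _)

/-- Attainment (in the limit `δ ↓ 0`) of the worst-case coverage over the LP ambiguity set:
for each `δ ∈ (0, ρ]` there is `Q` with `LP_ε(P,Q) ≤ ρ` and
`F_Q(q) ≤ F_P(q - ε) - ρ + δ`. -/
theorem lp_worst_case_coverage_attainment (P : Measure ℝ) [IsProbabilityMeasure P]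
    (ε q ρ : ℝ) (hε : 0 ≤ ε) (hρ0 : 0 < ρ) (hρ1 : ρ ≤ 1) (hρF : ρ ≤ cdf P (q - ε)) :
    ∀ δ : ℝ, 0 < δ → δ ≤ ρ →
      ∃ Q : Measure ℝ, IsProbabilityMeasure Q ∧
        LPdist ε P Q ≤ ENNReal.ofReal ρ ∧
        cdf Q q ≤ cdf P (q - ε) - ρ + δ := by
  intro δ hδ _
  have ha : 0 < cdf P (q - ε) := hρ0.trans_le hρF
  have hPA : P (Set.Iic (q - ε)) = ENNReal.ofReal (cdf P (q - ε)) :=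
    (ENNReal.ofReal_toReal (measure_ne_top _ _)).symm
  have ht0 : 0 ≤ ρ / cdf P (q - ε) := by positivity
  have ht1 : 0 ≤ 1 - ρ / cdf P (q - ε) := sub_nonneg.2 ((div_le_one ha).2 hρF)
  set c := ENNReal.ofReal (1 - ρ / cdf P (q - ε)) with hc
  set d := ENNReal.ofReal (ρ / cdf P (q - ε)) with hd
  have hcd : c + d = 1 := by
    rw [hc, hd, ← ENNReal.ofReal_add ht1 ht0, sub_add_cancel, ENNReal.ofReal_one]
  have hfst := splitCoupling_map_fst P ε q hcd
  have hγ : IsProbabilityMeasure (splitCoupling P ε q c d) := by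
    refine ⟨?_⟩
    rw [← Set.preimage_univ (f := Prod.fst), ← Measure.map_apply measurable_fst .univ, hfst,
      measure_univ]
  refine ⟨(splitCoupling P ε q c d).map Prod.snd,
    Measure.isProbabilityMeasure_map measurable_snd.aemeasurable, ?_, ?_⟩
  · refine (iInf₂_le (splitCoupling P ε q c d) ⟨hfst, rfl⟩).trans
      ((splitCoupling_far_le P hε q c d).trans_eq ?_)
    rw [hPA, hd, ← ENNReal.ofReal_mul ht0, div_mul_cancel₀ _ ha.ne']
  · have h := splitCoupling_map_snd_Iic_le P ε q c d
    rw [hPA, hc, ← ENNReal.ofReal_mul ht1, sub_mul, one_mul, div_mul_cancel₀ _ ha.ne'] at h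
    have h' := ENNReal.toReal_le_of_le_ofReal (sub_nonneg.2 hρF) h
    exact h'.trans (le_add_of_nonneg_right hδ.le)
end
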